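/- arXiv:1012.3918 — 2 statements merged into one kernel-verified Lean document; each statement's English description precedes it below -/
import Mathlib

section
/- For every integer d ≥ 2, every family F of m distinct finite sets, and every real number p with 0 ≤ p ≤ 1, the family F contains a B_d-free subfamily of size at least m·p − p^{2^d} · C(m, ⌈log₂(d+2)⌉), where C(m,k) denotes the binomial coefficient. -/
/-- A family `B` of finite sets forms a Boolean algebra of dimension `d`. -/
def IsBooleanAlgebraDim {α : Type*} [DecidableEq α] (d : ℕ) (B : Finset (Finset α)) : Prop :=
  ∃ f : Finset (Fin d) → Finset α, Function.Injective f ∧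
    (∀ I J : Finset (Fin d), f (I ∪ J) = f I ∪ f J ∧ f (I ∩ J) = f I ∩ f J) ∧
    B = Finset.image f Finset.univ

/-- A family is `B_d`-free if no subfamily forms a Boolean algebra of dimension `d`. -/
def IsBdFree {α : Type*} [DecidableEq α] (d : ℕ) (F : Finset (Finset α)) : Prop :=
  ∀ B ⊆ F, ¬ IsBooleanAlgebraDim d B

open Finset in
/-- There is an injective labelling of `Fin d` by nonempty proper subsets of a set of
`⌈log₂ (d + 2)⌉` points, and it separates these points. -/
theorem exists_separating_labelling (d : ℕ) (hd : 1 ≤ d) :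
    ∃ t : Fin d → Finset (Fin (Nat.clog 2 (d + 2))), Function.Injective t ∧
      (∀ i, t i ≠ ∅) ∧ (∀ i, t i ≠ univ) ∧
      ∀ a b, (∀ i, a ∈ t i ↔ b ∈ t i) → a = b := by
  set k := Nat.clog 2 (d + 2)
  have hpow : d + 2 ≤ 2 ^ k := Nat.le_pow_clog (by norm_num) _
  have hmin : ¬ d + 2 ≤ 2 ^ (k - 1) ∨ k = 0 := by
    by_cases h : d + 2 ≤ 2 ^ (k - 1)
    · have : k ≤ k - 1 := Nat.clog_le_of_le_pow h
      omega
    · exact Or.inl h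
  clear_value k
  have hcard : (univ : Finset (Fin d)).card ≤
      ((univ : Finset (Finset (Fin k))) \ {∅, univ}).card := by
    have h := le_card_sdiff ({∅, univ} : Finset (Finset (Fin k))) univ
    have h2 : ({∅, univ} : Finset (Finset (Fin k))).card ≤ 2 := card_le_two
    simp only [card_univ, Fintype.card_finset, Fintype.card_fin] at h ⊢
    omega
  obtain ⟨e⟩ : Nonempty ((univ : Finset (Fin d)) ↪
      ((univ : Finset (Finset (Fin k))) \ {∅, univ} : Finset (Finset (Fin k)))) :=
    Function.Embedding.nonempty_of_card_le (by simpa only [Fintype.card_coe] using hcard)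
  let t : Fin d → Finset (Fin k) := fun i => e ⟨i, mem_univ i⟩
  have hinj : Function.Injective t := fun i j hij =>
    congrArg Subtype.val (e.injective (Subtype.ext hij))
  have hmem : ∀ i, t i ≠ ∅ ∧ t i ≠ univ := fun i => by
    simpa using (mem_sdiff.1 (e ⟨i, mem_univ i⟩).2).2
  clear_value t
  refine ⟨t, hinj, fun i => (hmem i).1, fun i => (hmem i).2, fun a b hab => ?_⟩
  by_contra hne
  have hle : (univ : Finset (Fin d)).card ≤
      (((univ.erase b).powerset.erase ∅).erase (univ.erase b)).card := by
    refine card_le_card_of_injOn (fun i => (t i).erase b) (fun i _ => ?_) (fun i _ j _ hij => ?_)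
    · simp only [coe_erase, Set.mem_sdiff, Set.mem_singleton_iff, mem_coe, mem_powerset]
      refine ⟨⟨erase_subset_erase _ (subset_univ _), fun h => (hmem i).1 ?_⟩,
        fun h => (hmem i).2 ?_⟩
      · ext c
        have hc := Finset.ext_iff.1 h c
        have ha := Finset.ext_iff.1 h a
        have := hab i
        grind
      · ext c
        have hc := Finset.ext_iff.1 h c
        have ha := Finset.ext_iff.1 h a
        have := hab i
        grind
    · apply hinj
      ext c
      have hc := Finset.ext_iff.1 hij c
      have ha := Finset.ext_iff.1 hij a
      have := hab i
      have := hab j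
      grind
  have hnonempty : (univ.erase b) ≠ ∅ := ne_empty_of_mem (mem_erase.2 ⟨hne, mem_univ a⟩)
  rw [card_erase_of_mem (mem_erase.2 ⟨hnonempty, mem_powerset.2 subset_rfl⟩),
    card_erase_of_mem (empty_mem_powerset _), card_powerset, card_erase_of_mem (mem_univ b),
    card_univ, card_univ, Fintype.card_fin, Fintype.card_fin] at hle
  have := b.2
  omega

section BooleanAlgebra

variable {α : Type*} [DecidableEq α] {d : ℕ}

/-- `X` lies between the intersection and the union of `S` and is a union of cells of the
Venn diagram of `S`. -/
def IsVennUnion (S : Finset (Finset α)) (X : Finset α) : Prop :=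
  (∀ x, (∀ s ∈ S, x ∈ s) → x ∈ X) ∧ (∀ x ∈ X, ∃ s ∈ S, x ∈ s) ∧
    ∀ x y, (∀ s ∈ S, x ∈ s ↔ y ∈ s) → x ∈ X → y ∈ X

theorem IsBooleanAlgebraDim.card_eq {B : Finset (Finset α)} (h : IsBooleanAlgebraDim d B) :
    B.card = 2 ^ d := by
  obtain ⟨f, hf, -, rfl⟩ := h
  simp [Finset.card_image_of_injective _ hf]

theorem mem_iff_of_map_union {f : Finset (Fin d) → Finset α}
    (hf : ∀ I J, f (I ∪ J) = f I ∪ f J) (x : α) (I : Finset (Fin d)) :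
    x ∈ f I ↔ x ∈ f ∅ ∨ ∃ i ∈ I, x ∈ f {i} := by
  induction I using Finset.induction_on with
  | empty => simp
  | insert a s _ ih =>
    rw [Finset.insert_eq, hf, Finset.mem_union, ih]
    simp only [Finset.mem_union, Finset.mem_singleton, or_and_right, exists_or, exists_eq_left]
    tauto

/-- A Boolean algebra of dimension `d` contains `⌈log₂ (d + 2)⌉` members that determine it. -/
theorem IsBooleanAlgebraDim.exists_determining (hd : 1 ≤ d) {B : Finset (Finset α)}
    (h : IsBooleanAlgebraDim d B) :
    ∃ S ⊆ B, S.card = Nat.clog 2 (d + 2) ∧ ∀ X, X ∈ B ↔ IsVennUnion S X := by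
  obtain ⟨f, hinj, hf, rfl⟩ := h
  obtain ⟨t, ht, hempty, huniv, hsep⟩ := exists_separating_labelling d hd
  have hmem := mem_iff_of_map_union (fun I J => (hf I J).1)
  have huniq : ∀ x i, x ∉ f ∅ → x ∈ f {i} → ∀ J, x ∈ f J ↔ i ∈ J := by
    intro x i hx hi J
    refine ⟨fun hJ => ?_, fun hiJ => (hmem x J).2 (Or.inr ⟨i, hiJ, hi⟩)⟩
    by_contra hiJ
    have := (hf {i} J).2
    rw [Finset.singleton_inter_of_notMem hiJ] at this
    exact hx (this ▸ Finset.mem_inter.2 ⟨hi, hJ⟩)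
  let T : Fin (Nat.clog 2 (d + 2)) → Finset (Fin d) := fun a => {i | a ∈ t i}
  have hT : ∀ a i, i ∈ T a ↔ a ∈ t i := by simp [T]
  have hTinj : Function.Injective T := fun a b hab =>
    hsep a b fun i => by rw [← hT, ← hT, hab]
  have hcell : ∀ x, (∃ a, x ∈ f (T a)) → (¬ ∀ a, x ∈ f (T a)) → ∃ i, x ∉ f ∅ ∧ x ∈ f {i} := by
    rintro x ⟨a, ha⟩ hx
    have h0 : x ∉ f ∅ := fun h0 => hx fun b => (hmem _ _).2 (Or.inl h0)
    obtain h | ⟨i, -, hi⟩ := (hmem _ _).1 ha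
    · exact absurd h h0
    · exact ⟨i, h0, hi⟩
  let i₀ : Fin d := ⟨0, hd⟩
  obtain ⟨a₀, -⟩ := Finset.nonempty_iff_ne_empty.2 (hempty i₀)
  have hbot : ∀ x, (∀ a, x ∈ f (T a)) → x ∈ f ∅ := by
    intro x hx
    by_contra h0
    obtain h | ⟨i, -, hi⟩ := (hmem _ _).1 (hx a₀)
    · exact h0 h
    · exact huniv i (Finset.eq_univ_of_forall fun a =>
        (hT a i).1 ((huniq x i h0 hi _).1 (hx a)))
  refine ⟨Finset.univ.image fun a => f (T a), ?_, ?_, fun X => ?_⟩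
  · intro s hs
    obtain ⟨a, -, rfl⟩ := Finset.mem_image.1 hs
    exact Finset.mem_image_of_mem _ (Finset.mem_univ _)
  · exact (Finset.card_image_of_injective _ (hinj.comp hTinj)).trans
      (Finset.card_univ.trans (Fintype.card_fin _))
  simp only [IsVennUnion, Finset.mem_image, Finset.mem_univ, true_and, forall_exists_index,
    forall_apply_eq_imp_iff, exists_exists_eq_and]
  constructor
  · rintro ⟨I, rfl⟩
    refine ⟨fun x hx => (hmem _ _).2 (Or.inl (hbot x hx)), fun x hx => ?_, fun x y hxy hx => ?_⟩
    · obtain h | ⟨i, -, hi⟩ := (hmem _ _).1 hx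
      · exact ⟨a₀, (hmem _ _).2 (Or.inl h)⟩
      · obtain ⟨a, ha⟩ := Finset.nonempty_iff_ne_empty.2 (hempty i)
        exact ⟨a, (hmem _ _).2 (Or.inr ⟨i, (hT a i).2 ha, hi⟩)⟩
    · by_cases hall : ∀ a, x ∈ f (T a)
      · exact (hmem _ _).2 (Or.inl (hbot y fun a => (hxy a).1 (hall a)))
      have hex : ∃ a, x ∈ f (T a) := by
        obtain h | ⟨i, -, hi⟩ := (hmem _ _).1 hx
        · exact ⟨a₀, (hmem _ _).2 (Or.inl h)⟩
        · obtain ⟨a, ha⟩ := Finset.nonempty_iff_ne_empty.2 (hempty i)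
          exact ⟨a, (hmem _ _).2 (Or.inr ⟨i, (hT a i).2 ha, hi⟩)⟩
      obtain ⟨i, hx0, hxi⟩ := hcell x hex hall
      obtain ⟨j, hy0, hyj⟩ := hcell y (by simpa only [hxy] using hex)
        (by simpa only [hxy] using hall)
      have hij : i = j := ht <| by
        ext a
        rw [← hT, ← hT, ← huniq x i hx0 hxi, ← huniq y j hy0 hyj, hxy]
      subst hij
      exact (huniq y i hy0 hyj I).2 ((huniq x i hx0 hxi I).1 hx)
  · rintro ⟨hinter, hunion, hcongr⟩
    classical
    refine ⟨Finset.univ.filter fun i => ∃ x ∈ X, x ∈ f {i} ∧ x ∉ f ∅, ?_⟩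
    ext x
    constructor
    · intro hx
      by_cases h0 : x ∈ f ∅
      · exact hinter x fun a => (hmem _ _).2 (Or.inl h0)
      obtain h | ⟨i, hiI, hi⟩ := (hmem _ _).1 hx
      · exact absurd h h0
      obtain ⟨-, y, hyX, hyi, hy0⟩ := Finset.mem_filter.1 hiI
      exact hcongr y x (fun a => by rw [huniq y i hy0 hyi, huniq x i h0 hi]) hyX
    · intro hx
      rw [hmem]
      by_cases h0 : x ∈ f ∅
      · exact Or.inl h0
      obtain ⟨a, ha⟩ := hunion x hx
      obtain h | ⟨i, -, hi⟩ := (hmem _ _).1 ha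
      · exact absurd h h0
      · exact Or.inr ⟨i, Finset.mem_filter.2 ⟨Finset.mem_univ _, x, hx, hi, h0⟩, hi⟩

open Classical in
/-- A family of `m` sets contains at most `m.choose ⌈log₂ (d + 2)⌉` Boolean algebras of
dimension `d`. -/
theorem card_filter_isBooleanAlgebraDim_le (hd : 1 ≤ d) (F : Finset (Finset α)) :
    (F.powerset.filter (IsBooleanAlgebraDim d)).card ≤
      F.card.choose (Nat.clog 2 (d + 2)) := by
  rw [← Finset.card_powersetCard]
  have h : ∀ B : Finset (Finset α), ∃ S : Finset (Finset α), IsBooleanAlgebraDim d B →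
      S ⊆ B ∧ S.card = Nat.clog 2 (d + 2) ∧ ∀ X, X ∈ B ↔ IsVennUnion S X := by
    intro B
    by_cases hB : IsBooleanAlgebraDim d B
    · obtain ⟨S, hS⟩ := hB.exists_determining hd
      exact ⟨S, fun _ => hS⟩
    · exact ⟨∅, fun hB' => absurd hB' hB⟩
  choose S hS using h
  refine Finset.card_le_card_of_injOn S (fun B hB => ?_) (fun B hB C hC hBC => ?_)
  · rw [Finset.mem_coe, Finset.mem_filter, Finset.mem_powerset] at hB
    obtain ⟨hsub, hcard, -⟩ := hS B hB.2
    exact Finset.mem_coe.2 (Finset.mem_powersetCard.2 ⟨hsub.trans hB.1, hcard⟩)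
  · rw [Finset.mem_coe, Finset.mem_filter] at hB hC
    ext X
    rw [(hS B hB.2).2.2, (hS C hC.2).2.2, hBC]

end BooleanAlgebra

section Alteration

open Finset

variable {β : Type*} [DecidableEq β]

/-- A random subset of `F` with independent membership probabilities `p` contains a fixed
subset `C` with probability `p ^ #C`. -/
theorem sum_powerset_filter_superset_weight {R : Type*} [CommRing R] {C F : Finset β}
    (hC : C ⊆ F) (p : R) :
    ∑ G ∈ F.powerset with C ⊆ G, p ^ G.card * (1 - p) ^ (F \ G).card = p ^ C.card := by
  have h := Finset.prod_add (fun _ => p) (fun a => if a ∈ C then 0 else 1 - p) F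
  have hl : ∏ a ∈ F, (p + if a ∈ C then 0 else 1 - p) = p ^ C.card := by
    rw [← prod_sdiff hC, prod_congr rfl (g := fun _ => (1 : R)), prod_const_one, one_mul,
      prod_congr rfl (g := fun _ => p), prod_const]
    · intro a ha
      simp [ha]
    · intro a ha
      simp [(mem_sdiff.1 ha).2]
  rw [← hl, h, sum_filter]
  refine sum_congr rfl fun G hG => ?_
  rw [prod_const]
  split_ifs with hCG
  · congr 1
    rw [prod_congr rfl (g := fun _ => 1 - p), prod_const]
    intro a ha
    rw [if_neg fun haC => (mem_sdiff.1 ha).2 (hCG haC)]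
  · obtain ⟨a, haC, haG⟩ := not_subset.1 hCG
    have hzero : ∏ b ∈ F \ G, (if b ∈ C then 0 else 1 - p) = 0 :=
      prod_eq_zero (mem_sdiff.2 ⟨hC haC, haG⟩) (if_pos haC)
    rw [hzero, mul_zero]

/-- In an `n`-uniform hypergraph with edge set `E` on `F` some vertex set `G` has at least
`p * #F - p ^ n * #E` more vertices than edges. -/
theorem exists_subset_le_card_sub_card_edges {F : Finset β} {E : Finset (Finset β)} {n : ℕ}
    (hE : ∀ B ∈ E, B ⊆ F ∧ B.card = n) {p : ℝ} (hp0 : 0 ≤ p) (hp1 : p ≤ 1) :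
    ∃ G ⊆ F, (F.card : ℝ) * p - p ^ n * E.card ≤ G.card - (E.filter (· ⊆ G)).card := by
  let w : Finset β → ℝ := fun G => p ^ G.card * (1 - p) ^ (F \ G).card
  have hw : ∀ G, 0 ≤ w G := fun G =>
    mul_nonneg (pow_nonneg hp0 _) (pow_nonneg (sub_nonneg.2 hp1) _)
  have hsum : ∀ C ⊆ F, ∑ G ∈ F.powerset, w G * (if C ⊆ G then 1 else 0) = p ^ C.card := by
    intro C hC
    rw [← sum_powerset_filter_superset_weight hC p, sum_filter]
    simp only [mul_ite, mul_one, mul_zero, w]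
  have hone : ∑ G ∈ F.powerset, w G = 1 := by
    simpa using hsum ∅ (empty_subset _)
  have hvertices : ∑ G ∈ F.powerset, w G * (G.card : ℝ) = F.card * p := by
    have : ∀ G ∈ F.powerset, w G * (G.card : ℝ) =
        ∑ a ∈ F, w G * (if {a} ⊆ G then 1 else 0) := by
      intro G hG
      rw [← mul_sum, sum_boole]
      simp only [singleton_subset_iff, filter_mem_eq_inter,
        inter_eq_right.2 (mem_powerset.1 hG)]
    rw [sum_congr rfl this, sum_comm,
      sum_congr rfl fun a ha => hsum {a} (singleton_subset_iff.2 ha)]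
    simp
  have hedges : ∑ G ∈ F.powerset, w G * ((E.filter (· ⊆ G)).card : ℝ) = p ^ n * E.card := by
    have : ∀ G ∈ F.powerset, w G * ((E.filter (· ⊆ G)).card : ℝ) =
        ∑ B ∈ E, w G * (if B ⊆ G then 1 else 0) := by
      intro G _
      rw [← mul_sum, sum_boole]
    rw [sum_congr rfl this, sum_comm, sum_congr rfl fun B hB => hsum B (hE B hB).1,
      sum_congr rfl fun B hB => by rw [(hE B hB).2], sum_const, nsmul_eq_mul, mul_comm]
  by_contra! hlt
  set c : ℝ := (F.card : ℝ) * p - p ^ n * E.card with hc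
  have hzero : ∑ G ∈ F.powerset, w G * (c - (G.card - (E.filter (· ⊆ G)).card)) = 0 := by
    simp only [mul_sub, sum_sub_distrib, hvertices, hedges, ← sum_mul, hone]
    rw [hc]
    ring
  have hterm := (sum_eq_zero_iff_of_nonneg fun G hG =>
    mul_nonneg (hw G) (sub_pos.2 (hlt G (mem_powerset.1 hG))).le).1 hzero
  have hwzero : ∀ G ∈ F.powerset, w G = 0 := fun G hG =>
    (mul_eq_zero.1 (hterm G hG)).resolve_right (sub_pos.2 (hlt G (mem_powerset.1 hG))).ne'
  rw [sum_eq_zero hwzero] at hone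
  exact zero_ne_one hone

/-- Deleting one vertex from each edge of a hypergraph leaves a large edge-free set. -/
theorem exists_subset_edge_free (G : Finset β) (E : Finset (Finset β))
    (hE : ∀ B ∈ E, B.Nonempty) :
    ∃ H ⊆ G, (∀ B ∈ E, ¬ B ⊆ H) ∧ G.card ≤ H.card + (E.filter (· ⊆ G)).card := by
  obtain hβ | hβ := isEmpty_or_nonempty β
  · exact ⟨G, subset_rfl, fun B hB => isEmptyElim (hE B hB).choose, by omega⟩
  choose! v hv using hE
  refine ⟨G \ (E.filter (· ⊆ G)).image v, sdiff_subset, fun B hB hBH => ?_, ?_⟩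
  · exact (mem_sdiff.1 (hBH (hv B hB))).2
      (mem_image_of_mem v (mem_filter.2 ⟨hB, hBH.trans sdiff_subset⟩))
  · have h₁ := le_card_sdiff ((E.filter (· ⊆ G)).image v) G
    have h₂ : ((E.filter (· ⊆ G)).image v).card ≤ _ := card_image_le
    omega

end Alteration

theorem bd_free_probabilistic_bound {α : Type*} [DecidableEq α]
    (d : ℕ) (hd : 2 ≤ d) (m : ℕ) (F : Finset (Finset α)) (hF : F.card = m)
    (p : ℝ) (hp0 : 0 ≤ p) (hp1 : p ≤ 1) :
    ∃ G ⊆ F, IsBdFree d G ∧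
      (m : ℝ) * p - p ^ (2 ^ d) * (m.choose (Nat.clog 2 (d + 2)) : ℝ) ≤ (G.card : ℝ) := by
  classical
  subst hF
  let E := F.powerset.filter (IsBooleanAlgebraDim d)
  have hE : ∀ B ∈ E, B ⊆ F ∧ B.card = 2 ^ d := fun B hB =>
    ⟨Finset.mem_powerset.1 (Finset.mem_filter.1 hB).1, (Finset.mem_filter.1 hB).2.card_eq⟩
  obtain ⟨G, hGF, hG⟩ := exists_subset_le_card_sub_card_edges hE hp0 hp1
  obtain ⟨H, hHG, hfree, hcard⟩ := exists_subset_edge_free G E fun B hB =>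
    Finset.card_pos.1 ((hE B hB).2 ▸ by positivity)
  refine ⟨H, hHG.trans hGF, fun B hBH hB => hfree B ?_ hBH, ?_⟩
  · exact Finset.mem_filter.2 ⟨Finset.mem_powerset.2 (hBH.trans (hHG.trans hGF)), hB⟩
  · have hEcard : (E.card : ℝ) ≤ F.card.choose (Nat.clog 2 (d + 2)) := by
      exact_mod_cast card_filter_isBooleanAlgebraDim_le (by omega) F
    have hmul := mul_le_mul_of_nonneg_left hEcard (pow_nonneg hp0 (2 ^ d))
    have hcard' : (G.card : ℝ) ≤ H.card + (E.filter (· ⊆ G)).card := by exact_mod_cast hcard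
    linarith
end

section
/- Let a ≥ 2, let A be an antichain of finite sets (distinct and pairwise incomparable under inclusion), and let C be a chain of finite sets (totally ordered by inclusion) whose maximum member belongs to A. Then the family A ∪ C is a-union free. -/
/-- A family `F` is `a`-union free: no `a` distinct members of `F` have union equal to
another member of `F`. -/
def IsUnionFree {α : Type*} [DecidableEq α] (a : ℕ) (F : Finset (Finset α)) : Prop :=
  ∀ S : Finset (Finset α), S ⊆ F → S.card = a → ∀ T ∈ F, T ∉ S → S.sup id ≠ T

theorem Finset.sup_id_mem_of_isChain {α : Type*} [DecidableEq α] {S : Finset (Finset α)}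
    (hne : S.Nonempty) (hS : IsChain (· ⊆ ·) (↑S : Set (Finset α))) : S.sup id ∈ S := by
  obtain ⟨m, hm⟩ := S.exists_maximal hne
  have hle : S.sup id ≤ m := Finset.sup_le fun X hX =>
    (hS.total hX hm.prop).elim id fun h => hm.le_of_ge hX h
  rw [le_antisymm hle (Finset.le_sup (f := id) hm.prop)]
  exact hm.prop

theorem antichain_union_chain_is_union_free {α : Type*} [DecidableEq α]
    (a : ℕ) (ha : 2 ≤ a) (A C : Finset (Finset α))
    (hA : IsAntichain (· ⊆ ·) (↑A : Set (Finset α)))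
    (hC : IsChain (· ⊆ ·) (↑C : Set (Finset α)))
    (htop : ∃ M ∈ C, (∀ X ∈ C, X ⊆ M) ∧ M ∈ A) :
    IsUnionFree a (A ∪ C) := by
  rintro S hS hcard T hT hTS rfl
  obtain ⟨M, -, hCM, hMA⟩ := htop
  have hSC : S ⊆ C := by
    intro X hX
    refine (Finset.mem_union.mp (hS hX)).resolve_left fun hXA => hTS ?_
    have hXT : X ⊆ S.sup id := Finset.le_sup (f := id) hX
    rcases Finset.mem_union.mp hT with hTA | hTC
    · rwa [← hA.eq hXA hTA hXT]
    · have hTM := hCM _ hTC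
      have hXM : X = M := hA.eq hXA hMA (hXT.trans hTM)
      rwa [hTM.antisymm (hXM ▸ hXT), ← hXM]
  exact hTS (Finset.sup_id_mem_of_isChain (Finset.card_pos.mp (by lia))
    (hC.mono (Finset.coe_subset.mpr hSC)))
end
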